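/- arXiv:1411.7547 — 3 statements merged into one kernel-verified Lean document; each statement's English description precedes it below -/
import Mathlib

section
/- Let D be the space of real-valued càdlàg functions on ℝ≥0 with the σ-algebra 𝒟 generated by the evaluation maps u ↦ u(s), s ≥ 0, and let D↑ ⊂ D be the subset of nonnegative, increasing (non-decreasing) càdlàg functions. Then the composition map (u,v) ↦ u∘v, where (u∘v)(t) := u(v(t)), from D × D↑ (with the trace of the product σ-algebra 𝒟⊗𝒟) to D is (𝒟⊗𝒟, 𝒟)-measurable; equivalently, for every t ≥ 0 the map (u,v) ↦ u(v(t)) on D × D↑ is 𝒟⊗𝒟-measurable. -/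
open MeasureTheory Filter Topology Set
open scoped NNReal

noncomputable section

/-- A real-valued function on `ℝ≥0` is càdlàg: right-continuous with left limits. -/
def IsCadlag (u : ℝ≥0 → ℝ) : Prop :=
  (∀ t : ℝ≥0, ContinuousWithinAt u (Set.Ici t) t) ∧
  (∀ t : ℝ≥0, 0 < t → ∃ l : ℝ, Tendsto u (𝓝[<] t) (𝓝 l))

/-- `D`, the space of real-valued càdlàg functions on `ℝ≥0`. -/
def D : Type := {u : ℝ≥0 → ℝ // IsCadlag u}

/-- The σ-algebra `𝒟` on `D` generated by the evaluation maps `u ↦ u s`. -/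
instance : MeasurableSpace D :=
  ⨆ s : ℝ≥0, MeasurableSpace.comap (fun u : D => u.1 s) inferInstance

/-- `D↑ ⊆ D`, the subset of nonnegative increasing càdlàg functions, with the trace
σ-algebra (the subtype σ-algebra, i.e. the trace of `𝒟`). -/
def Dup : Type := {v : D // Monotone v.1 ∧ ∀ s, 0 ≤ v.1 s}

instance : MeasurableSpace Dup := Subtype.instMeasurableSpace

/-- The evaluation maps on `D` are measurable. -/
theorem measurable_eval_D (s : ℝ≥0) : Measurable fun u : D => u.1 s :=
  Measurable.of_comap_le (le_iSup
    (fun s : ℝ≥0 => MeasurableSpace.comap (fun u : D => u.1 s) inferInstance) s)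

/-- The smallest multiple of `1 / (n + 1)` strictly above `x`, as a function of `x`, converges to
`x` from the right. -/
theorem tendsto_floor_mul_add_one_div (x : ℝ≥0) :
    Tendsto (fun n : ℕ => ((⌊x * (n + 1)⌋₊ + 1 : ℕ) : ℝ≥0) / (n + 1)) atTop (𝓝[≥] x) := by
  have hpos (n : ℕ) : (0 : ℝ≥0) < n + 1 := by positivity
  have hlower (n : ℕ) : x ≤ ((⌊x * (n + 1)⌋₊ + 1 : ℕ) : ℝ≥0) / (n + 1) := by
    rw [le_div_iff₀ (hpos n)]
    exact_mod_cast (Nat.lt_floor_add_one (x * ((n : ℝ≥0) + 1))).le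
  refine tendsto_nhdsWithin_iff.2 ⟨?_, .of_forall hlower⟩
  have hlim : Tendsto (fun n : ℕ => x + 1 / ((n : ℝ≥0) + 1)) atTop (𝓝 x) := by
    simpa using (tendsto_one_div_add_atTop_nhds_zero_nat (𝕜 := ℝ≥0)).const_add x
  refine tendsto_of_tendsto_of_tendsto_of_le_of_le tendsto_const_nhds hlim hlower fun n => ?_
  rw [div_le_iff₀ (hpos n), add_mul, one_div, inv_mul_cancel₀ (hpos n).ne']
  push_cast
  gcongr
  exact Nat.floor_le zero_le

/-- Evaluation of càdlàg functions is jointly measurable in the function and the time. -/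
theorem measurable_eval_D_prod : Measurable fun p : D × ℝ≥0 => p.1.1 p.2 := by
  refine measurable_of_tendsto_metrizable
    (f := fun (n : ℕ) (p : D × ℝ≥0) =>
      p.1.1 (((⌊p.2 * (n + 1)⌋₊ + 1 : ℕ) : ℝ≥0) / (n + 1))) (fun n => ?_) ?_
  · have hgrid : Measurable fun q : D × ℕ => q.1.1 (((q.2 + 1 : ℕ) : ℝ≥0) / (n + 1)) :=
      measurable_from_prod_countable_left fun k =>
        measurable_eval_D (((k + 1 : ℕ) : ℝ≥0) / (n + 1))
    exact hgrid.comp (measurable_fst.prodMk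
      (Nat.measurable_floor.comp (measurable_snd.mul_const _)))
  · exact tendsto_pi_nhds.2 fun p =>
      (p.1.2.1 p.2).tendsto.comp (tendsto_floor_mul_add_one_div p.2)

/-- the composition map `(u, v) ↦ u ∘ v` from `D × D↑` to `D` is
`(𝒟 ⊗ 𝒟, 𝒟)`-measurable; since `𝒟` is generated by the evaluations, this is equivalent to:
for every `t ≥ 0`, the map `(u, v) ↦ u (v t)` on `D × D↑` is `𝒟 ⊗ 𝒟`-measurable. -/
theorem stmt_0 (t : ℝ≥0) :
    Measurable fun p : D × Dup => p.1.1 ((p.2.1.1 t).toNNReal) := by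
  have htime : Measurable fun v : Dup => (v.1.1 t).toNNReal :=
    ((measurable_eval_D t).comp measurable_subtype_coe).real_toNNReal
  exact measurable_eval_D_prod.comp (measurable_fst.prodMk (htime.comp measurable_snd))
end
end

section
/- Proposition 1 (first claim, σ-algebra ℋ_{t−}): Fix t > 0 and let A : Ω → [0,∞) be ℋ_{t−}-measurable, where ℋ_{t−} := σ(∪_{s<t} ℋ_s). Then there exists a 𝒟⊗𝒟-measurable function H : D×D → [0,∞) such that A(ω) = H(X_·(ω), Z_·(ω)) for P-a.s. ω, and such that for P-a.s. ω̃ ∈ Ω held fixed, the map ω ↦ H(X_·(ω̃), Z_·(ω)) is ℱ^Z_{t−}-measurable, where ℱ^Z_{t−} := σ(∪_{s<t} ℱ^Z_s). -/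
open MeasureTheory Filter Topology Set
open scoped NNReal ENNReal

noncomputable section

variable {Ω : Type*} {E : Type*}

/-- The σ-algebra generated by the `μ`-null sets (used for the augmentation `·^P`). -/
def nullSets [MeasurableSpace Ω] (μ : Measure Ω) : MeasurableSpace Ω :=
  MeasurableSpace.generateFrom {s : Set Ω | μ s = 0}

/-- The raw canonical filtration `σ(Y_s : s ≤ t)` of a process `Y`. -/
def natF [MeasurableSpace E] (Y : ℝ≥0 → Ω → E) (t : ℝ≥0) : MeasurableSpace Ω :=
  ⨆ s ∈ Set.Iic t, MeasurableSpace.comap (Y s) inferInstance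

/-- `ℱ^Y_t`: the right-continuous `P`-completed canonical filtration of `Y`. -/
def rcF [MeasurableSpace Ω] [MeasurableSpace E] (μ : Measure Ω) (Y : ℝ≥0 → Ω → E)
    (t : ℝ≥0) : MeasurableSpace Ω :=
  ⨅ u ∈ Set.Ioi t, (natF Y u ⊔ nullSets μ)

/-- `ℱ^Y_∞ := σ(⋃ t, ℱ^Y_t)`. -/
def rcFinf [MeasurableSpace Ω] [MeasurableSpace E] (μ : Measure Ω) (Y : ℝ≥0 → Ω → E) :
    MeasurableSpace Ω :=
  ⨆ t : ℝ≥0, rcF μ Y t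

/-- The σ-algebra generated by the whole process `Y`. -/
def sigmaProc [MeasurableSpace E] (Y : ℝ≥0 → Ω → E) : MeasurableSpace Ω :=
  ⨆ s : ℝ≥0, MeasurableSpace.comap (Y s) inferInstance

/-- `ℋ_t := (ℱ^X_∞ ∨ ℱ^Z_t)^P`. -/
def Hfilt [MeasurableSpace Ω] (μ : Measure Ω) (X : ℝ≥0 → Ω → ℝ) (Z : ℝ≥0 → Ω → ℝ≥0)
    (t : ℝ≥0) : MeasurableSpace Ω :=
  (rcFinf μ X ⊔ rcF μ Z t) ⊔ nullSets μ

/-- `ℱ_t := (ℱ^{X_Z}_t ∨ ℱ^Z_t)^P`, where `(X_Z)_t ω := X (Z t ω) ω`. -/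
def Ffilt [MeasurableSpace Ω] (μ : Measure Ω) (X : ℝ≥0 → Ω → ℝ) (Z : ℝ≥0 → Ω → ℝ≥0)
    (t : ℝ≥0) : MeasurableSpace Ω :=
  (rcF μ (fun u ω => X (Z u ω) ω) t ⊔ rcF μ Z t) ⊔ nullSets μ

open scoped Classical in
lemma measurable_toReal_iInf_rat [MeasurableSpace Ω] {S : ℚ → Set Ω}
    (hS : ∀ q, MeasurableSet (S q)) :
    Measurable fun ω => (⨅ q : ℚ, if ω ∈ S q then ((q : ℝ) : EReal) else ⊤).toReal :=
  measurable_ereal_toReal.comp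
    (Measurable.iInf fun q => Measurable.ite (hS q) measurable_const measurable_const)

/-- A real function measurable for `m` modulo null sets is a.e. equal to an `m`-measurable one. -/
lemma exists_measurable_ae_eq_of_eventuallyMeasurable {m : MeasurableSpace Ω}
    [MeasurableSpace Ω] {μ : Measure Ω} {A : Ω → ℝ} (hA : EventuallyMeasurable m (ae μ) A) :
    ∃ B : Ω → ℝ, Measurable[m] B ∧ A =ᵐ[μ] B := by
  classical
  have hS : ∀ q : ℚ, ∃ S : Set Ω, MeasurableSet[m] S ∧ {ω | A ω < q} =ᵐ[μ] S :=
    fun q => hA (measurableSet_Iio (a := (q : ℝ)))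
  choose S hSm hSA using hS
  refine ⟨_, @measurable_toReal_iInf_rat _ m S hSm, ?_⟩
  have hall : ∀ᵐ ω ∂μ, ∀ q : ℚ, A ω < q ↔ ω ∈ S q :=
    ae_all_iff.2 fun q => (hSA q).mem_iff
  filter_upwards [hall] with ω hω
  have hinf : (⨅ q : ℚ, if ω ∈ S q then ((q : ℝ) : EReal) else ⊤) = (A ω : EReal) := by
    refine le_antisymm (le_of_forall_gt fun c hc => ?_) (le_iInf fun q => ?_)
    · obtain ⟨q, hq, hqc⟩ := EReal.lt_iff_exists_rat_btwn.1 hc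
      refine (iInf_le _ q).trans_lt ?_
      rwa [if_pos ((hω q).1 (by exact_mod_cast hq))]
    · split_ifs with h
      · exact_mod_cast ((hω q).2 h).le
      · exact le_top
  simp only [hinf, EReal.toReal_coe]

lemma nullSets_le_eventuallyMeasurableSpace (m : MeasurableSpace Ω) [MeasurableSpace Ω]
    (μ : Measure Ω) : nullSets μ ≤ eventuallyMeasurableSpace m (ae μ) :=
  MeasurableSpace.generateFrom_le fun _ hs => ⟨∅, @MeasurableSet.empty _ m, ae_eq_empty.2 hs⟩

lemma rcF_le_of_lt [MeasurableSpace Ω] [MeasurableSpace E] (μ : Measure Ω) (Y : ℝ≥0 → Ω → E)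
    {s u : ℝ≥0} (h : s < u) : rcF μ Y s ≤ natF Y u ⊔ nullSets μ :=
  iInf₂_le u h

lemma natF_le_rcF [MeasurableSpace Ω] [MeasurableSpace E] (μ : Measure Ω) (Y : ℝ≥0 → Ω → E)
    (s : ℝ≥0) : natF Y s ≤ rcF μ Y s :=
  le_iInf₂ fun _ hu => le_sup_of_le_left (biSup_mono fun _ hr => Set.Iic_subset_Iic.2 (le_of_lt hu) hr)

lemma rcFinf_le [MeasurableSpace Ω] [MeasurableSpace E] (μ : Measure Ω) (Y : ℝ≥0 → Ω → E) :
    rcFinf μ Y ≤ sigmaProc Y ⊔ nullSets μ :=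
  iSup_le fun s => (rcF_le_of_lt μ Y (lt_add_one s)).trans
    (sup_le_sup_right (iSup₂_le fun r _ => le_iSup _ r) _)

/-- `ℋ_{t-}` is contained in the completion of `σ(X) ∨ σ(Z_u : u < t)`. -/
lemma iSup_Hfilt_le [MeasurableSpace Ω] (μ : Measure Ω) (X : ℝ≥0 → Ω → ℝ)
    (Z : ℝ≥0 → Ω → ℝ≥0) (t : ℝ≥0) :
    ⨆ s ∈ Set.Iio t, Hfilt μ X Z s ≤
      (sigmaProc X ⊔ ⨆ u ∈ Set.Iio t, MeasurableSpace.comap (Z u) inferInstance) ⊔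
        nullSets μ := by
  refine iSup₂_le fun s hs => sup_le (sup_le ?_ ?_) le_sup_right
  · exact (rcFinf_le μ X).trans (sup_le_sup_right le_sup_left _)
  · obtain ⟨u, hsu, hut⟩ := exists_between (Set.mem_Iio.1 hs)
    refine (rcF_le_of_lt μ Z hsu).trans (sup_le_sup_right (le_sup_of_le_right ?_) _)
    exact biSup_mono fun _ hr => lt_of_le_of_lt hr hut

lemma iSup_comap_le_iSup_rcF [MeasurableSpace Ω] [MeasurableSpace E] (μ : Measure Ω)
    (Y : ℝ≥0 → Ω → E) (t : ℝ≥0) :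
    ⨆ u ∈ Set.Iio t, MeasurableSpace.comap (Y u) inferInstance ≤
      ⨆ s ∈ Set.Iio t, rcF μ Y s :=
  iSup₂_mono fun u _ =>
    le_trans (le_iSup₂_of_le u (Set.mem_Iic.2 le_rfl) le_rfl) (natF_le_rcF μ Y u)

/-- The path map of a process with càdlàg paths. -/
def path (Y : ℝ≥0 → Ω → ℝ) (hY : ∀ ω, IsCadlag fun s => Y s ω) (ω : Ω) : D :=
  ⟨fun s => Y s ω, hY ω⟩

/-- The σ-algebra on `D` generated by the evaluations at times strictly before `t`. -/
def pathBefore (t : ℝ≥0) : MeasurableSpace D :=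
  ⨆ s ∈ Set.Iio t, MeasurableSpace.comap (fun u : D => u.1 s) inferInstance

lemma pathBefore_le (t : ℝ≥0) : pathBefore t ≤ (inferInstance : MeasurableSpace D) :=
  iSup₂_le fun s _ => le_iSup (fun s : ℝ≥0 => MeasurableSpace.comap (fun u : D => u.1 s) _) s

/-- `σ(X) ∨ σ(Z_u : u < t)` is generated by the pair of paths, the second one being observed
strictly before `t`. -/
lemma sigmaProc_sup_le_comap_paths (X : ℝ≥0 → Ω → ℝ) (Z : ℝ≥0 → Ω → ℝ≥0)
    (hX : ∀ ω, IsCadlag fun s => X s ω) (hZ : ∀ ω, IsCadlag fun s => (Z s ω : ℝ)) (t : ℝ≥0) :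
    (sigmaProc X ⊔ ⨆ u ∈ Set.Iio t, MeasurableSpace.comap (Z u) inferInstance) ≤
      MeasurableSpace.comap
        (fun ω => (path X hX ω, path (fun s ω => (Z s ω : ℝ)) hZ ω))
        (MeasurableSpace.prod inferInstance (pathBefore t)) := by
  rw [MeasurableSpace.prod, MeasurableSpace.comap_sup, MeasurableSpace.comap_comp,
    MeasurableSpace.comap_comp]
  refine sup_le_sup (iSup_le fun s => ?_) (iSup₂_le fun s hs => ?_)
  · rintro _ ⟨B, hB, rfl⟩
    refine ⟨(fun u : D => u.1 s) ⁻¹' B, ?_, rfl⟩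
    exact le_iSup (fun s : ℝ≥0 => MeasurableSpace.comap (fun u : D => u.1 s) _) s _ ⟨B, hB, rfl⟩
  · rintro _ ⟨B, hB, rfl⟩
    refine ⟨(fun u : D => u.1 s) ⁻¹' (Real.toNNReal ⁻¹' B), ?_, ?_⟩
    · exact le_iSup₂ (f := fun (s : ℝ≥0) (_ : s ∈ Set.Iio t) =>
        MeasurableSpace.comap (fun u : D => u.1 s) _) s hs _
          ⟨_, measurable_real_toNNReal hB, rfl⟩
    · ext ω
      change Real.toNNReal (Z s ω) ∈ B ↔ Z s ω ∈ B
      rw [Real.toNNReal_coe]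

lemma measurable_path_pathBefore (Z : ℝ≥0 → Ω → ℝ≥0)
    (hZ : ∀ ω, IsCadlag fun s => (Z s ω : ℝ)) (t : ℝ≥0) :
    Measurable[⨆ u ∈ Set.Iio t, MeasurableSpace.comap (Z u) inferInstance, pathBefore t]
      (path (fun s ω => (Z s ω : ℝ)) hZ) := by
  rw [measurable_iff_comap_le, pathBefore, MeasurableSpace.comap_iSup]
  refine iSup_le fun s => ?_
  rw [MeasurableSpace.comap_iSup]
  refine iSup_le fun hs => ?_
  rw [MeasurableSpace.comap_comp]
  refine le_iSup₂_of_le s hs ?_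
  rintro _ ⟨B, hB, rfl⟩
  exact ⟨_, measurable_coe_nnreal_real hB, rfl⟩

/-- STATEMENT 2 (Proposition 1, first claim, σ-algebra `ℋ_{t−} := σ(⋃_{s<t} ℋ_s)`),
with `ℱ^Z_{t−} := σ(⋃_{s<t} ℱ^Z_s)`. -/
theorem stmt_2 [MeasurableSpace Ω] (μ : Measure Ω) [IsProbabilityMeasure μ] [μ.IsComplete]
    (X : ℝ≥0 → Ω → ℝ) (Z : ℝ≥0 → Ω → ℝ≥0)
    (hXmeas : ∀ s, Measurable (X s)) (hZmeas : ∀ s, Measurable (Z s))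
    (hX : ∀ ω, IsCadlag fun s => X s ω)
    (hZ : ∀ ω, IsCadlag fun s => (Z s ω : ℝ))
    (hZmono : ∀ ω, Monotone fun s => Z s ω)
    (hindep : ProbabilityTheory.Indep (sigmaProc X) (sigmaProc Z) μ)
    (t : ℝ≥0) (ht : 0 < t) (A : Ω → ℝ) (hA0 : ∀ ω, 0 ≤ A ω)
    (hA : Measurable[⨆ s ∈ Set.Iio t, Hfilt μ X Z s] A) :
    ∃ H : D × D → ℝ, Measurable H ∧ (∀ p, 0 ≤ H p) ∧
      (∀ᵐ ω ∂μ, A ω = H (⟨fun s => X s ω, hX ω⟩, ⟨fun s => (Z s ω : ℝ), hZ ω⟩)) ∧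
      (∀ᵐ ω' ∂μ, Measurable[⨆ s ∈ Set.Iio t, rcF μ Z s]
        fun ω => H (⟨fun s => X s ω', hX ω'⟩, ⟨fun s => (Z s ω : ℝ), hZ ω⟩)) := by
  obtain ⟨B, hBm, hAB⟩ := exists_measurable_ae_eq_of_eventuallyMeasurable (μ := μ)
    (m := sigmaProc X ⊔ ⨆ u ∈ Set.Iio t, MeasurableSpace.comap (Z u) inferInstance)
    (hA.mono ((iSup_Hfilt_le μ X Z t).trans (sup_le le_eventuallyMeasurableSpace
      (nullSets_le_eventuallyMeasurableSpace _ μ))) le_rfl)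
  obtain ⟨h, hh, hBh⟩ := Measurable.exists_eq_measurable_comp
    (mY := MeasurableSpace.prod inferInstance (pathBefore t))
    (hBm.mono (sigmaProc_sup_le_comap_paths X Z hX hZ t) le_rfl)
  have hsec : ∀ x : D, Measurable[pathBefore t] fun z => h (x, z) := fun x =>
    hh.comp (@measurable_prodMk_left D D inferInstance (pathBefore t) x)
  refine ⟨fun p => max (h p) 0, ?_, fun p => le_max_right _ _, ?_, ?_⟩
  · refine Measurable.max (hh.mono ?_ le_rfl) measurable_const
    exact sup_le_sup le_rfl (MeasurableSpace.comap_mono (pathBefore_le t))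
  · filter_upwards [hAB] with ω hω
    have hB : B ω = h (⟨fun s => X s ω, hX ω⟩, ⟨fun s => (Z s ω : ℝ), hZ ω⟩) := congrFun hBh ω
    rw [← hB, ← hω, max_eq_left (hA0 ω)]
  · refine Eventually.of_forall fun ω' => ?_
    refine Measurable.max ?_ measurable_const
    exact ((hsec _).comp (measurable_path_pathBefore Z hZ t)).mono
      (iSup_comap_le_iSup_rcF μ Z t) le_rfl
end
end

section
/- Explicit compensator density for a skew Brownian motion subordinated by a Gamma subordinator (computation (14) of the example): Let c > 0, λ > 0, β ∈ [−1,1], x ∈ ℝ, and y ∈ ℝ with y ≠ 0 and x + y ≠ 0, and set φ := |x| + |x+y|. Then ∫₀^∞ (c/z) e^{−λ z} · (1/√(2πz)) · ( e^{−y²/(2z)} + (β/sgn(x+y)) e^{−φ²/(2z)} ) dz = c e^{−√(2λ)|y|}/|y| + (β/sgn(x+y)) · c e^{−√(2λ)φ}/φ. -/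
open MeasureTheory Set

open Filter Topology in
/-- The improper fundamental theorem of calculus for a nonnegative derivative, with a limit at the
left endpoint in place of continuity. -/
theorem integrableOn_and_integral_Ioi_of_hasDerivAt_of_nonneg {g g' : ℝ → ℝ} {a m l : ℝ}
    (hleft : Tendsto g (𝓝[>] a) (𝓝 m)) (hderiv : ∀ z ∈ Ioi a, HasDerivAt g (g' z) z)
    (hpos : ∀ z ∈ Ioi a, 0 ≤ g' z) (hg : Tendsto g atTop (𝓝 l)) :
    IntegrableOn g' (Ioi a) ∧ ∫ z in Ioi a, g' z = l - m := by
  have hcont : ContinuousWithinAt (Function.update g a m) (Ici a) a := by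
    rw [continuousWithinAt_update_same, Ici_sdiff_left]
    exact hleft
  have hd : ∀ z ∈ Ioi a, HasDerivAt (Function.update g a m) (g' z) z := fun z hz => by
    refine (hderiv z hz).congr_of_eventuallyEq ?_
    filter_upwards [Ioi_mem_nhds hz] with w hw
    exact Function.update_of_ne (ne_of_gt hw) _ _
  have htop : Tendsto (Function.update g a m) atTop (𝓝 l) := by
    refine hg.congr' ?_
    filter_upwards [Ioi_mem_atTop a] with w hw
    exact (Function.update_of_ne (ne_of_gt hw) _ _).symm
  refine ⟨integrableOn_Ioi_deriv_of_nonneg hcont hd hpos htop, ?_⟩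
  simpa using integral_Ioi_of_hasDerivAt_of_nonneg hcont hd hpos htop

/-- The primitive, vanishing at `0`, of `u ↦ exp (-u ^ 2 / 2)`. -/
noncomputable def gaussPrimitive (t : ℝ) : ℝ := ∫ u in (0 : ℝ)..t, Real.exp (-(1 / 2) * u ^ 2)

theorem hasDerivAt_gaussPrimitive (t : ℝ) :
    HasDerivAt gaussPrimitive (Real.exp (-(1 / 2) * t ^ 2)) t := by
  have h : Continuous fun u : ℝ => Real.exp (-(1 / 2) * u ^ 2) := by fun_prop
  exact (h.integral_hasStrictDerivAt 0 t).hasDerivAt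

theorem gaussPrimitive_neg (t : ℝ) : gaussPrimitive (-t) = -gaussPrimitive t := by
  have h := intervalIntegral.integral_comp_neg (a := 0) (b := t)
    (fun u : ℝ => Real.exp (-(1 / 2) * u ^ 2))
  simp only [neg_sq, neg_zero] at h
  rw [gaussPrimitive, gaussPrimitive, h, intervalIntegral.integral_symm]

open Filter Topology in
theorem tendsto_gaussPrimitive_atTop :
    Tendsto gaussPrimitive atTop (𝓝 (Real.sqrt (2 * Real.pi) / 2)) := by
  have h := intervalIntegral_tendsto_integral_Ioi (0 : ℝ)
    (integrable_exp_neg_mul_sq (b := 1 / 2) (by norm_num)).integrableOn tendsto_id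
  rw [integral_gaussian_Ioi, show Real.pi / (1 / 2) = 2 * Real.pi by ring] at h
  exact h

open Filter Topology in
theorem tendsto_gaussPrimitive_atBot :
    Tendsto gaussPrimitive atBot (𝓝 (-(Real.sqrt (2 * Real.pi) / 2))) := by
  refine (tendsto_gaussPrimitive_atTop.comp tendsto_neg_atBot_atTop).neg.congr fun t => ?_
  simp [gaussPrimitive_neg]

open Filter Topology in
/-- The Laplace transform of the unnormalised hitting-time density of Brownian motion at level
`a`, together with the integrability of the integrand. -/
theorem integrableOn_and_integral_hittingDensity {lam a : ℝ} (hlam : 0 < lam) (ha : 0 < a) :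
    IntegrableOn (fun z : ℝ => 1 / z * Real.exp (-(lam * z)) * (1 / Real.sqrt (2 * Real.pi * z)) *
        Real.exp (-(a ^ 2) / (2 * z))) (Ioi 0) ∧
      ∫ z in Ioi (0 : ℝ), 1 / z * Real.exp (-(lam * z)) * (1 / Real.sqrt (2 * Real.pi * z)) *
        Real.exp (-(a ^ 2) / (2 * z)) = Real.exp (-(Real.sqrt (2 * lam) * a)) / a := by
  set s := Real.sqrt (2 * lam) with hs
  have hs0 : 0 < s := Real.sqrt_pos.2 (by positivity)
  have hs2 : s ^ 2 = 2 * lam := Real.sq_sqrt (by positivity)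
  set p := Real.sqrt (2 * Real.pi) with hp
  have hp0 : 0 < p := Real.sqrt_pos.2 (by positivity)
  let u : ℝ → ℝ := fun z => s * Real.sqrt z - a / Real.sqrt z
  let v : ℝ → ℝ := fun z => -(s * Real.sqrt z + a / Real.sqrt z)
  let g : ℝ → ℝ := fun z => Real.exp (-(s * a)) / (a * p) *
    (gaussPrimitive (u z) + Real.exp (2 * (s * a)) * gaussPrimitive (v z))
  have hsqrt0 : Tendsto Real.sqrt (𝓝[>] 0) (𝓝 0) := by
    simpa using (Real.continuous_sqrt.tendsto 0).mono_left nhdsWithin_le_nhds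
  have hsqrt0' : Tendsto Real.sqrt (𝓝[>] 0) (𝓝[>] 0) := by
    refine tendsto_nhdsWithin_iff.2 ⟨hsqrt0, ?_⟩
    filter_upwards [self_mem_nhdsWithin] with z hz using Real.sqrt_pos.2 hz
  have hdiv0 : Tendsto (fun z => a / Real.sqrt z) (𝓝[>] 0) atTop := by
    simpa only [div_eq_mul_inv, Function.comp_apply] using
      (tendsto_inv_nhdsGT_zero.comp hsqrt0').const_mul_atTop ha
  have hdivtop : Tendsto (fun z => a / Real.sqrt z) atTop (𝓝 0) :=
    tendsto_const_nhds.div_atTop Real.tendsto_sqrt_atTop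
  have hmultop : Tendsto (fun z => s * Real.sqrt z) atTop atTop :=
    Real.tendsto_sqrt_atTop.const_mul_atTop hs0
  have hu0 : Tendsto u (𝓝[>] 0) atBot := by
    simpa only [u, sub_eq_add_neg, Function.comp_apply] using
      (hsqrt0.const_mul s).add_atBot (tendsto_neg_atTop_atBot.comp hdiv0)
  have hv0 : Tendsto v (𝓝[>] 0) atBot :=
    tendsto_neg_atTop_atBot.comp ((hsqrt0.const_mul s).add_atTop hdiv0)
  have hutop : Tendsto u atTop atTop := by
    simpa only [u, sub_eq_add_neg] using hmultop.atTop_add hdivtop.neg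
  have hvtop : Tendsto v atTop atBot :=
    tendsto_neg_atTop_atBot.comp (hmultop.atTop_add hdivtop)
  have hleft := ((tendsto_gaussPrimitive_atBot.comp hu0).add
    ((tendsto_gaussPrimitive_atBot.comp hv0).const_mul (Real.exp (2 * (s * a))))).const_mul
      (Real.exp (-(s * a)) / (a * p))
  have hright := ((tendsto_gaussPrimitive_atTop.comp hutop).add
    ((tendsto_gaussPrimitive_atBot.comp hvtop).const_mul (Real.exp (2 * (s * a))))).const_mul
      (Real.exp (-(s * a)) / (a * p))
  have key := integrableOn_and_integral_Ioi_of_hasDerivAt_of_nonneg (g := g)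
    (g' := fun z : ℝ => 1 / z * Real.exp (-(lam * z)) * (1 / Real.sqrt (2 * Real.pi * z)) *
        Real.exp (-(a ^ 2) / (2 * z))) hleft ?_ ?_ hright
  · refine ⟨key.1, key.2.trans ?_⟩
    rw [← hp]
    field_simp
    ring
  · intro z hz
    have hz0 : (0 : ℝ) < z := hz
    have hw0 : 0 < Real.sqrt z := Real.sqrt_pos.2 hz0
    have hw2 : z = Real.sqrt z ^ 2 := (Real.sq_sqrt hz0.le).symm
    have hw : HasDerivAt Real.sqrt (1 / (2 * Real.sqrt z)) z := Real.hasDerivAt_sqrt hz0.ne'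
    have hq : HasDerivAt (fun z => a / Real.sqrt z)
        (-(a * (1 / (2 * Real.sqrt z))) / Real.sqrt z ^ 2) z :=
      ((hasDerivAt_const z a).div hw hw0.ne').congr_deriv (by ring)
    have hu := (hasDerivAt_gaussPrimitive (u z)).comp z ((hw.const_mul s).sub hq)
    have hv := (hasDerivAt_gaussPrimitive (v z)).comp z ((hw.const_mul s).add hq).neg
    have hd := (hu.add (hv.const_mul (Real.exp (2 * (s * a))))).const_mul
      (Real.exp (-(s * a)) / (a * p))
    refine hd.congr_deriv ?_
    have hue : Real.exp (-(1 / 2) * u z ^ 2) =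
        Real.exp (-(lam * z)) * Real.exp (-(a ^ 2) / (2 * z)) * Real.exp (s * a) := by
      rw [← Real.exp_add, ← Real.exp_add]
      congr 1
      have : lam = s ^ 2 / 2 := by linarith
      have hexp : ∀ w : ℝ, 0 < w → -(1 / 2) * (s * w - a / w) ^ 2 =
          -(s ^ 2 / 2 * w ^ 2) + -(a ^ 2) / (2 * w ^ 2) + s * a := fun w hw => by
        field_simp
        ring
      rw [this, hexp _ hw0, ← hw2]
    have hve : Real.exp (2 * (s * a)) * Real.exp (-(1 / 2) * v z ^ 2) =
        Real.exp (-(1 / 2) * u z ^ 2) := by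
      rw [← Real.exp_add]
      congr 1
      simp only [u, v]
      field_simp
      ring
    have hsp : Real.sqrt (2 * Real.pi * z) = p * Real.sqrt z :=
      Real.sqrt_mul (by positivity) z
    rw [← mul_assoc (Real.exp (2 * (s * a))), hve, hue, hsp, Real.exp_neg (s * a)]
    have hz1 : 1 / z = 1 / Real.sqrt z ^ 2 := by rw [← hw2]
    rw [hz1]
    field_simp
    ring
  · intro z hz
    have hz0 : (0 : ℝ) < z := hz
    positivity

/-- explicit compensator density for a skew Brownian motion subordinated
by a Gamma subordinator: for `c, λ > 0`, `β ∈ [−1,1]`, `y ≠ 0`, `x + y ≠ 0` and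
`φ := |x| + |x+y|`,
`∫₀^∞ (c/z) e^{−λz} (1/√(2πz)) (e^{−y²/(2z)} + (β/sgn(x+y)) e^{−φ²/(2z)}) dz
  = c e^{−√(2λ)|y|}/|y| + (β/sgn(x+y)) c e^{−√(2λ)φ}/φ`. -/
theorem stmt_14 (c lam β x y : ℝ) (hc : 0 < c) (hlam : 0 < lam)
    (hβ : β ∈ Set.Icc (-1 : ℝ) 1) (hy : y ≠ 0) (hxy : x + y ≠ 0) :
    ∫ z in Set.Ioi (0:ℝ),
        (c / z) * Real.exp (-(lam * z)) * (1 / Real.sqrt (2 * Real.pi * z)) *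
          (Real.exp (-(y^2) / (2*z)) +
            (β / Real.sign (x + y)) * Real.exp (-((|x| + |x+y|)^2) / (2*z)))
      = c * Real.exp (-(Real.sqrt (2*lam) * |y|)) / |y| +
          (β / Real.sign (x + y)) *
            (c * Real.exp (-(Real.sqrt (2*lam) * (|x| + |x+y|))) / (|x| + |x+y|)) := by
  have hφ : 0 < |x| + |x + y| := by positivity
  obtain ⟨hi₁, he₁⟩ := integrableOn_and_integral_hittingDensity hlam (abs_pos.2 hy)
  obtain ⟨hi₂, he₂⟩ := integrableOn_and_integral_hittingDensity hlam hφ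
  rw [sq_abs] at hi₁ he₁
  rw [mul_div_assoc, mul_div_assoc, ← he₁, ← he₂, ← integral_const_mul, ← integral_const_mul,
    ← integral_const_mul, ← integral_add (hi₁.const_mul c) ((hi₂.const_mul c).const_mul _)]
  refine integral_congr_ae (ae_of_all _ fun z => ?_)
  ring
end
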